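/- In a free Lie algebra L(V) over ℤ on a set of generators of cardinality at least two, the center is trivial. -/

import Mathlib

namespace FreeLieAlgebra

attribute [local instance] LieRing.ofAssociativeRing

open TensorProduct LieAlgebra

variable {R : Type*} [CommRing R] {X : Type*}

@[elab_as_elim]
theorem induction_on {p : FreeLieAlgebra R X → Prop} (a : FreeLieAlgebra R X)
    (of : ∀ x, p (of R x)) (zero : p 0) (add : ∀ a b, p a → p b → p (a + b))
    (smul : ∀ (r : R) a, p a → p (r • a)) (lie : ∀ a b, p a → p b → p ⁅a, b⁆) : p a := by
  let K : LieSubalgebra R (FreeLieAlgebra R X) :=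
    { carrier := {a | p a}
      add_mem' := fun ha hb => add _ _ ha hb
      zero_mem' := zero
      smul_mem' := fun r _ ha => smul r _ ha
      lie_mem' := fun ha hb => lie _ _ ha hb }
  have h : K.incl.comp (lift R fun x => (⟨FreeLieAlgebra.of R x, of x⟩ : K)) = LieHom.id := by
    ext x
    simp
  have := LieHom.congr_fun h a
  simp only [LieHom.comp_apply, LieSubalgebra.coe_incl, LieHom.coe_id, id] at this
  rw [← this]
  exact Subtype.prop _

section Derivation

/-- The Lie algebra homomorphism `a ↦ a + ε D a`, where `D` is the derivation extending `f`. -/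
noncomputable def toDual (f : X → FreeLieAlgebra R X) :
    FreeLieAlgebra R X →ₗ⁅R⁆ DualNumber R ⊗[R] FreeLieAlgebra R X :=
  lift R fun x => 1 ⊗ₜ of R x + DualNumber.eps ⊗ₜ f x

variable (R) in
/-- The constant term of an element of `L[ε]`. -/
noncomputable def dualFst (L : Type*) [AddCommGroup L] [Module R L] : DualNumber R ⊗[R] L →ₗ[R] L :=
  (TensorProduct.lid R L).toLinearMap ∘ₗ (TrivSqZeroExt.fstHom R R R).toLinearMap.rTensor L

variable (R) in
/-- The coefficient of `ε` in an element of `L[ε]`. -/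
noncomputable def dualSnd (L : Type*) [AddCommGroup L] [Module R L] : DualNumber R ⊗[R] L →ₗ[R] L :=
  (TensorProduct.lid R L).toLinearMap ∘ₗ (TrivSqZeroExt.sndHom R R).rTensor L

@[simp]
theorem dualFst_tmul {L : Type*} [AddCommGroup L] [Module R L] (s : DualNumber R) (a : L) :
    dualFst R L (s ⊗ₜ a) = s.fst • a := rfl

@[simp]
theorem dualSnd_tmul {L : Type*} [AddCommGroup L] [Module R L] (s : DualNumber R) (a : L) :
    dualSnd R L (s ⊗ₜ a) = s.snd • a := rfl

variable {L : Type*} [LieRing L] [LieAlgebra R L]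

theorem dualFst_lie (u v : DualNumber R ⊗[R] L) :
    dualFst R L ⁅u, v⁆ = ⁅dualFst R L u, dualFst R L v⁆ := by
  induction u with
  | zero => rw [map_zero, zero_lie]; exact congrArg _ (zero_lie (L := DualNumber R ⊗[R] L) v) |>.trans (map_zero _)
  | add u u' hu hu' =>
    rw [map_add, add_lie, ← hu, ← hu', ← map_add]
    exact congrArg _ (add_lie u u' v)
  | tmul s a =>
    induction v with
    | zero =>
      rw [map_zero, lie_zero]
      exact congrArg _ (lie_zero (s ⊗ₜ[R] a)) |>.trans (map_zero _)
    | add v v' hv hv' =>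
      rw [map_add, lie_add, ← hv, ← hv', ← map_add]
      exact congrArg _ (lie_add (s ⊗ₜ[R] a) v v')
    | tmul t b =>
      simp only [LieAlgebra.ExtendScalars.bracket_tmul, dualFst_tmul, TrivSqZeroExt.fst_mul,
        smul_lie, lie_smul, mul_smul]
      rw [smul_comm]

theorem dualSnd_lie (u v : DualNumber R ⊗[R] L) :
    dualSnd R L ⁅u, v⁆ =
      ⁅dualFst R L u, dualSnd R L v⁆ - ⁅dualFst R L v, dualSnd R L u⁆ := by
  induction u with
  | zero =>
    simp only [map_zero, zero_lie, lie_zero, sub_zero]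
    exact congrArg _ (zero_lie (L := DualNumber R ⊗[R] L) v) |>.trans (map_zero _)
  | add u u' hu hu' =>
    simp only [map_add, add_lie, lie_add, add_sub_add_comm]
    rw [← hu, ← hu', ← map_add]
    exact congrArg _ (add_lie u u' v)
  | tmul s a =>
    induction v with
    | zero =>
      simp only [map_zero, zero_lie, lie_zero, sub_zero]
      exact congrArg _ (lie_zero (s ⊗ₜ[R] a)) |>.trans (map_zero _)
    | add v v' hv hv' =>
      simp only [map_add, add_lie, lie_add, add_sub_add_comm]
      rw [← hv, ← hv', ← map_add]
      exact congrArg _ (lie_add (s ⊗ₜ[R] a) v v')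
    | tmul t b =>
      rw [LieAlgebra.ExtendScalars.bracket_tmul]
      simp only [dualSnd_tmul, dualFst_tmul, TrivSqZeroExt.snd_mul, smul_lie, lie_smul, add_smul,
        smul_eq_mul, MulOpposite.smul_eq_mul_unop, MulOpposite.unop_op, mul_smul]
      rw [← lie_skew b a]
      simp only [smul_neg, sub_neg_eq_add]
      rw [smul_comm s.fst t.snd, smul_comm s.snd t.fst]

theorem dualFst_toDual (f : X → FreeLieAlgebra R X) (a : FreeLieAlgebra R X) :
    dualFst R _ (toDual f a) = a := by
  induction a using induction_on with
  | of x => simp [toDual]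
  | zero => simp
  | add a b ha hb => simp [ha, hb]
  | smul r a ha => simp [ha]
  | lie a b ha hb => rw [LieHom.map_lie, dualFst_lie, ha, hb]

/-- The derivation of a free Lie algebra with prescribed values on the generators. -/
noncomputable def derivation (f : X → FreeLieAlgebra R X) :
    LieDerivation R (FreeLieAlgebra R X) (FreeLieAlgebra R X) where
  toLinearMap := dualSnd R _ ∘ₗ (toDual f).toLinearMap
  leibniz' a b := by
    simp [dualSnd_lie, dualFst_toDual]

@[simp]
theorem derivation_of (f : X → FreeLieAlgebra R X) (x : X) : derivation f (of R x) = f x := by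
  change dualSnd R _ (toDual f (of R x)) = f x
  simp [toDual]

end Derivation

section Elimination

variable (R) in
/-- The derivation of the free Lie algebra on `Y × ℕ` sending `(y, n)` to `(y, n + 1)`. -/
noncomputable def shift (Y : Type*) :
    LieDerivation R (FreeLieAlgebra R (Y × ℕ)) (FreeLieAlgebra R (Y × ℕ)) :=
  derivation fun z => of R (z.1, z.2 + 1)

variable (R) in
/-- The action of the one-dimensional Lie algebra through multiples of the shift. -/
noncomputable def shiftHom (Y : Type*) :
    R →ₗ⁅R⁆ LieDerivation R (FreeLieAlgebra R (Y × ℕ)) (FreeLieAlgebra R (Y × ℕ)) where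
  toFun k := k • shift R Y
  map_add' _ _ := add_smul _ _ _
  map_smul' _ _ := mul_smul _ _ _
  map_lie' {k l} := by simp [Ring.lie_def, mul_comm]

@[simp]
theorem shiftHom_apply (Y : Type*) (k : R) (c : FreeLieAlgebra R (Y × ℕ)) :
    shiftHom R Y k c = k • shift R Y c := rfl

open Classical in
variable (R) in
/-- Lazard elimination of the generator `x`: the generator `y ≠ x` is sent to `(y, 0)`, and `x` to
the element acting by the shift. -/
noncomputable def eliminate (x : X) :
    FreeLieAlgebra R X →ₗ⁅R⁆ FreeLieAlgebra R ({y // y ≠ x} × ℕ) ⋊⁅shiftHom R {y // y ≠ x}⁆ R :=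
  lift R fun y => if h : y = x then ⟨0, 1⟩ else ⟨of R (⟨y, h⟩, 0), 0⟩

@[simp]
theorem eliminate_self (x : X) : eliminate R x (of R x) = ⟨0, 1⟩ := by
  simp [eliminate]

theorem eliminate_of_ne {x y : X} (h : y ≠ x) :
    eliminate R x (of R y) = ⟨of R (⟨y, h⟩, 0), 0⟩ := by
  simp [eliminate, h]

variable (R) in
/-- The homomorphism sending `(y, n)` to `(ad x) ^ n y`. -/
noncomputable def adPow (x : X) :
    FreeLieAlgebra R ({y // y ≠ x} × ℕ) →ₗ⁅R⁆ FreeLieAlgebra R X :=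
  lift R fun z => (fun b => ⁅of R x, b⁆)^[z.2] (of R z.1.1)

theorem adPow_shift (x : X) (c : FreeLieAlgebra R ({y // y ≠ x} × ℕ)) :
    adPow R x (shift R _ c) = ⁅of R x, adPow R x c⁆ := by
  induction c using induction_on with
  | of z => simp [shift, adPow, Function.iterate_succ_apply']
  | zero => simp
  | add a b ha hb => simp [ha, hb]
  | smul r a ha => simp [ha]
  | lie a b ha hb =>
    rw [LieDerivation.apply_lie_eq_sub, map_sub, LieHom.map_lie, LieHom.map_lie,
      LieHom.map_lie, ha, hb, leibniz_lie (of R x), ← lie_skew ⁅of R x, adPow R x a⁆]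
    abel

variable (R) in
/-- The inverse of Lazard elimination. -/
noncomputable def uneliminate (x : X) :
    FreeLieAlgebra R ({y // y ≠ x} × ℕ) ⋊⁅shiftHom R {y // y ≠ x}⁆ R →ₗ⁅R⁆ FreeLieAlgebra R X where
  toFun p := adPow R x p.left + p.right • of R x
  map_add' p q := by simp [add_smul]; abel
  map_smul' r p := by simp [mul_smul]
  map_lie' {p q} := by
    simp only [SemiDirectSum.lie_eq_mk, shiftHom_apply, map_sub, map_add,
      map_smul, LieHom.map_lie, adPow_shift, Ring.lie_def, mul_comm p.right, sub_self,
      zero_smul, add_zero, lie_add, add_lie, lie_smul, smul_lie, lie_self, smul_zero]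
    rw [← lie_skew (of R x) (adPow R x p.left)]
    simp only [smul_neg]
    abel

theorem uneliminate_eliminate (x : X) (a : FreeLieAlgebra R X) :
    uneliminate R x (eliminate R x a) = a := by
  suffices (uneliminate R x).comp (eliminate R x) = LieHom.id from LieHom.congr_fun this a
  ext y
  by_cases h : y = x
  · subst h
    simp [uneliminate]
  · simp [uneliminate, eliminate_of_ne h, adPow]

theorem exists_eliminate_eq (x : X) (c : FreeLieAlgebra R ({y // y ≠ x} × ℕ)) :
    ∃ a, eliminate R x a = ⟨c, 0⟩ := by
  induction c using induction_on with
  | of z =>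
    obtain ⟨y, n⟩ := z
    induction n with
    | zero => exact ⟨of R y.1, eliminate_of_ne y.2⟩
    | succ n ih =>
      obtain ⟨a, ha⟩ := ih
      exact ⟨⁅of R x, a⁆, by simp [ha, shift]⟩
  | zero => exact ⟨0, by simp⟩
  | add _ _ ha hb =>
    obtain ⟨a, ha⟩ := ha
    obtain ⟨b, hb⟩ := hb
    exact ⟨a + b, by simp [ha, hb]⟩
  | smul r _ ha =>
    obtain ⟨a, ha⟩ := ha
    exact ⟨r • a, by simp [ha]⟩
  | lie _ _ ha hb =>
    obtain ⟨a, ha⟩ := ha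
    obtain ⟨b, hb⟩ := hb
    exact ⟨⁅a, b⁆, by simp [ha, hb]⟩

variable (R) in
/-- The coefficient of the generator `x` in the abelianization. -/
noncomputable def linearCoeff [DecidableEq X] (x : X) : FreeLieAlgebra R X →ₗ⁅R⁆ R :=
  lift R (Pi.single x 1)

theorem eliminate_right_of_central [Nontrivial X] (x : X) {a : FreeLieAlgebra R X}
    (ha : ∀ b : FreeLieAlgebra R X, ⁅a, b⁆ = 0) : (eliminate R x a).right = 0 := by
  classical
  obtain ⟨y, hy⟩ := exists_ne x
  have h := congrArg (eliminate R x) (ha (of R y))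
  rw [LieHom.map_lie, eliminate_of_ne hy, map_zero] at h
  have h := congrArg (fun p => linearCoeff R ((⟨y, hy⟩, 1) : {y // y ≠ x} × ℕ) p.left) h
  simpa [shift, linearCoeff, Ring.lie_def, mul_comm] using h

theorem eliminate_left_central [Nontrivial X] (x : X) {a : FreeLieAlgebra R X}
    (ha : ∀ b : FreeLieAlgebra R X, ⁅a, b⁆ = 0) (c : FreeLieAlgebra R ({y // y ≠ x} × ℕ)) :
    ⁅(eliminate R x a).left, c⁆ = 0 := by
  obtain ⟨b, hb⟩ := exists_eliminate_eq x c
  have h := congrArg (eliminate R x) (ha b)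
  rw [LieHom.map_lie, hb, map_zero] at h
  simpa [eliminate_right_of_central x ha] using congrArg SemiDirectSum.left h

end Elimination

section Filtration

variable (R) in
/-- `IsMonomial R S n a` says that `a` is an iterated bracket of `n` generators from `S`. -/
inductive IsMonomial (S : Set X) : ℕ → FreeLieAlgebra R X → Prop
  | of {x : X} (hx : x ∈ S) : IsMonomial S 1 (of R x)
  | lie {m n : ℕ} {a b : FreeLieAlgebra R X} (ha : IsMonomial S m a) (hb : IsMonomial S n b) :
      IsMonomial S (m + n) ⁅a, b⁆

theorem IsMonomial.pos {S : Set X} {n : ℕ} {a : FreeLieAlgebra R X} (h : IsMonomial R S n a) :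
    0 < n := by
  induction h <;> omega

theorem IsMonomial.mono {S T : Set X} (hST : S ⊆ T) {n : ℕ} {a : FreeLieAlgebra R X}
    (h : IsMonomial R S n a) : IsMonomial R T n a := by
  induction h with
  | of hx => exact .of (hST hx)
  | lie _ _ ha hb => exact .lie ha hb

theorem IsMonomial.exists_finite {S : Set X} {n : ℕ} {a : FreeLieAlgebra R X}
    (h : IsMonomial R S n a) : ∃ T : Set X, T.Finite ∧ IsMonomial R T n a := by
  induction h with
  | @of x hx => exact ⟨{x}, Set.finite_singleton x, .of rfl⟩
  | lie _ _ ha hb =>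
    obtain ⟨T, hT, ha⟩ := ha
    obtain ⟨U, hU, hb⟩ := hb
    exact ⟨T ∪ U, hT.union hU,
      .lie (ha.mono Set.subset_union_left) (hb.mono Set.subset_union_right)⟩

variable (R) in
/-- The span of the monomials of length less than `n` and of those of length `n` in the generators
from `S`. -/
noncomputable def filtration (n : ℕ) (S : Set X) : Submodule R (FreeLieAlgebra R X) :=
  Submodule.span R {a | (∃ m < n, IsMonomial R Set.univ m a) ∨ IsMonomial R S n a}

theorem filtration_mono {n : ℕ} {S T : Set X} (h : S ⊆ T) :
    filtration R n S ≤ filtration R n T :=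
  Submodule.span_mono fun _ => Or.imp_right (IsMonomial.mono h)

theorem filtration_le_of_lt {m n : ℕ} (h : m < n) (S T : Set X) :
    filtration R m S ≤ filtration R n T := by
  refine Submodule.span_mono ?_
  rintro a (⟨l, hl, ha⟩ | ha)
  · exact .inl ⟨l, hl.trans h, ha⟩
  · exact .inl ⟨m, h, ha.mono (Set.subset_univ S)⟩

theorem lie_mem_filtration {m n : ℕ} {S : Set X} {a b : FreeLieAlgebra R X}
    (ha : a ∈ filtration R m S) (hb : b ∈ filtration R n S) : ⁅a, b⁆ ∈ filtration R (m + n) S := by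
  induction ha using Submodule.span_induction with
  | zero => simp
  | add a a' _ _ ha ha' => rw [add_lie]; exact add_mem ha ha'
  | smul r a _ ha => rw [smul_lie]; exact Submodule.smul_mem _ r ha
  | mem a ha =>
    induction hb using Submodule.span_induction with
    | zero => simp
    | add b b' _ _ hb hb' => rw [lie_add]; exact add_mem hb hb'
    | smul r b _ hb => rw [lie_smul]; exact Submodule.smul_mem _ r hb
    | mem b hb =>
      apply Submodule.subset_span
      rcases ha with ⟨k, hk, ha⟩ | ha <;> rcases hb with ⟨l, hl, hb⟩ | hb
      · exact .inl ⟨k + l, by omega, ha.lie hb⟩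
      · exact .inl ⟨k + n, by omega, ha.lie (hb.mono (Set.subset_univ S))⟩
      · exact .inl ⟨m + l, by omega, (ha.mono (Set.subset_univ S)).lie hb⟩
      · exact .inr (ha.lie hb)

theorem exists_mem_filtration (a : FreeLieAlgebra R X) :
    ∃ n, a ∈ filtration R n Set.univ := by
  induction a using induction_on with
  | of x => exact ⟨1, Submodule.subset_span (.inr (.of trivial))⟩
  | zero => exact ⟨0, zero_mem _⟩
  | add a b ha hb =>
    obtain ⟨m, ha⟩ := ha
    obtain ⟨n, hb⟩ := hb
    exact ⟨m + n + 1, add_mem (filtration_le_of_lt (by omega) _ _ ha)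
      (filtration_le_of_lt (by omega) _ _ hb)⟩
  | smul r a ha => exact ha.imp fun n h => Submodule.smul_mem _ r h
  | lie a b ha hb =>
    obtain ⟨m, ha⟩ := ha
    obtain ⟨n, hb⟩ := hb
    exact ⟨m + n, lie_mem_filtration ha hb⟩

theorem exists_finite_mem_filtration {n : ℕ} {a : FreeLieAlgebra R X}
    (ha : a ∈ filtration R (n + 1) ∅) : ∃ S : Set X, S.Finite ∧ a ∈ filtration R n S := by
  induction ha using Submodule.span_induction with
  | zero => exact ⟨∅, Set.finite_empty, zero_mem _⟩
  | add a b _ _ ha hb =>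
    obtain ⟨S, hS, ha⟩ := ha
    obtain ⟨T, hT, hb⟩ := hb
    exact ⟨S ∪ T, hS.union hT, add_mem (filtration_mono Set.subset_union_left ha)
      (filtration_mono Set.subset_union_right hb)⟩
  | smul r a _ ha => exact ha.imp fun S h => ⟨h.1, Submodule.smul_mem _ r h.2⟩
  | mem a ha =>
    obtain ⟨m, hm, ha⟩ : ∃ m < n + 1, ∃ T : Set X, IsMonomial R T m a := by
      rcases ha with ⟨m, hm, ha⟩ | ha
      · exact ⟨m, hm, _, ha⟩
      · exfalso
        generalize n + 1 = k at ha
        induction ha <;> contradiction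
    obtain ⟨T, ha⟩ := ha
    obtain ⟨S, hS, ha⟩ := ha.exists_finite
    refine ⟨S, hS, Submodule.subset_span ?_⟩
    rcases (Nat.lt_succ_iff.mp hm).lt_or_eq with h | h
    · exact .inl ⟨m, h, ha.mono (Set.subset_univ S)⟩
    · exact .inr (h ▸ ha)

theorem filtration_zero (S : Set X) : filtration R 0 S = ⊥ := by
  rw [filtration, Submodule.span_eq_bot]
  rintro a (⟨m, hm, -⟩ | ha)
  · omega
  · exact absurd ha.pos (lt_irrefl 0)

theorem shift_mem_filtration {Y : Type*} {n : ℕ} {S : Set (Y × ℕ)} {c : FreeLieAlgebra R (Y × ℕ)}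
    (hc : c ∈ filtration R n S) : shift R Y c ∈ filtration R n Set.univ := by
  have key : ∀ {m : ℕ} {T : Set (Y × ℕ)} {c : FreeLieAlgebra R (Y × ℕ)},
      IsMonomial R T m c → shift R Y c ∈ filtration R m Set.univ := by
    intro m T c h
    induction h with
    | of hx =>
      rw [shift, derivation_of]
      exact Submodule.subset_span (.inr (.of trivial))
    | @lie m n a b ha hb iha ihb =>
      rw [LieDerivation.apply_lie_eq_sub]
      have ha : a ∈ filtration R m Set.univ :=
        Submodule.subset_span (.inr (ha.mono (Set.subset_univ T)))
      have hb : b ∈ filtration R n Set.univ :=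
        Submodule.subset_span (.inr (hb.mono (Set.subset_univ T)))
      refine sub_mem (lie_mem_filtration ha ihb) ?_
      rw [add_comm m n]
      exact lie_mem_filtration hb iha
  induction hc using Submodule.span_induction with
  | zero => simp
  | add a b _ _ ha hb => rw [map_add]; exact add_mem ha hb
  | smul r a _ ha => rw [map_smul]; exact Submodule.smul_mem _ r ha
  | mem a ha =>
    rcases ha with ⟨m, hm, ha⟩ | ha
    · exact filtration_le_of_lt hm _ _ (key ha)
    · exact key ha

theorem IsMonomial.eliminate_left_mem {x : X} {S : Set X} {T : Set ({y // y ≠ x} × ℕ)}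
    (hST : ∀ y : {y // y ≠ x}, y.1 ∈ S → (y, 0) ∈ T) {n : ℕ} {a : FreeLieAlgebra R X}
    (ha : IsMonomial R S n a) : (eliminate R x a).left ∈ filtration R n T := by
  induction ha with
  | @of y hy =>
    by_cases h : y = x
    · subst h
      simp
    · rw [eliminate_of_ne h]
      exact Submodule.subset_span (.inr (.of (hST ⟨y, h⟩ hy)))
  | @lie m n a b ha hb iha ihb =>
    rw [LieHom.map_lie, SemiDirectSum.lie_eq_mk]
    have hm := ha.pos
    have hn := hb.pos
    refine sub_mem (add_mem (lie_mem_filtration iha ihb) ?_) ?_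
    · exact Submodule.smul_mem _ _
        (filtration_le_of_lt (by omega) _ _ (shift_mem_filtration ihb))
    · exact Submodule.smul_mem _ _
        (filtration_le_of_lt (by omega) _ _ (shift_mem_filtration iha))

theorem eliminate_left_mem_filtration {x : X} {S : Set X} {T : Set ({y // y ≠ x} × ℕ)}
    (hST : ∀ y : {y // y ≠ x}, y.1 ∈ S → (y, 0) ∈ T) {n : ℕ} {a : FreeLieAlgebra R X}
    (ha : a ∈ filtration R n S) : (eliminate R x a).left ∈ filtration R n T := by
  induction ha using Submodule.span_induction with
  | zero => simp
  | add a b _ _ ha hb => rw [map_add]; exact add_mem ha hb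
  | smul r a _ ha => rw [map_smul]; exact Submodule.smul_mem _ r ha
  | mem a ha =>
    rcases ha with ⟨m, hm, ha⟩ | ha
    · exact filtration_le_of_lt hm _ _
        (ha.eliminate_left_mem (T := Set.univ) fun _ _ => trivial)
    · exact ha.eliminate_left_mem hST

end Filtration

theorem eq_zero_of_central_of_mem_filtration (n : ℕ) :
    ∀ (X : Type*) [Nontrivial X] (a : FreeLieAlgebra R X),
      (∀ b : FreeLieAlgebra R X, ⁅a, b⁆ = 0) → a ∈ filtration R n ∅ → a = 0 := by
  induction n with
  | zero =>
    intro X _ a _ h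
    simpa [filtration_zero] using h
  | succ n ih =>
    have key : ∀ (k : ℕ) (X : Type _) [Nontrivial X] (a : FreeLieAlgebra R X) (S : Set X),
        (∀ b : FreeLieAlgebra R X, ⁅a, b⁆ = 0) → S.Finite → S.ncard ≤ k →
        a ∈ filtration R n S → a = 0 := by
      intro k
      induction k with
      | zero =>
        intro X _ a S ha hS hk h
        obtain rfl := (Set.ncard_eq_zero hS).mp (Nat.le_zero.mp hk)
        exact ih X a ha h
      | succ k ihk =>
        intro X _ a S ha hS hk h
        rcases S.eq_empty_or_nonempty with rfl | ⟨x, hx⟩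
        · exact ih X a ha h
        let T : Set ({y // y ≠ x} × ℕ) := {z | z.1.1 ∈ S ∧ z.2 = 0}
        have hmaps : ∀ z ∈ T, z.1.1 ∈ S \ {x} := fun z hz => ⟨hz.1, z.1.2⟩
        have hinj : Set.InjOn (fun z : {y // y ≠ x} × ℕ => z.1.1) T := fun z hz w hw hzw =>
          Prod.ext (Subtype.ext hzw) (hz.2.trans hw.2.symm)
        have hfin : T.Finite := Set.Finite.of_injOn hmaps hinj hS.sdiff
        have hcard : T.ncard ≤ k := by
          have h₁ := Set.ncard_le_ncard_of_injOn _ hmaps hinj hS.sdiff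
          have h₂ := Set.ncard_sdiff_singleton_add_one hx hS
          omega
        obtain ⟨y, hy⟩ := exists_ne x
        have : Nonempty {y // y ≠ x} := ⟨⟨y, hy⟩⟩
        have hleft := ihk _ _ T (eliminate_left_central x ha) hfin hcard
          (eliminate_left_mem_filtration (T := T) (fun y hy => ⟨hy, rfl⟩) h)
        have hzero : eliminate R x a = 0 :=
          SemiDirectSum.ext hleft (eliminate_right_of_central x ha)
        rw [← uneliminate_eliminate x a, hzero, map_zero]
    intro X _ a ha h
    obtain ⟨S, hS, h⟩ := exists_finite_mem_filtration h
    exact key S.ncard X a S ha hS le_rfl h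

theorem eq_zero_of_central [Nontrivial X] {a : FreeLieAlgebra R X}
    (ha : ∀ b : FreeLieAlgebra R X, ⁅a, b⁆ = 0) : a = 0 := by
  obtain ⟨n, hn⟩ := exists_mem_filtration a
  exact eq_zero_of_central_of_mem_filtration (n + 1) X a ha
    (filtration_le_of_lt n.lt_succ_self _ _ hn)

end FreeLieAlgebra

/-- The center of a free Lie algebra over `ℤ` on at least two generators is trivial. -/
theorem freeLieAlgebra_center_trivial (X : Type*) [Nontrivial X]
    (a : FreeLieAlgebra ℤ X) (ha : ∀ b : FreeLieAlgebra ℤ X, ⁅a, b⁆ = 0) :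
    a = 0 := by
  exact FreeLieAlgebra.eq_zero_of_central ha
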